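/- Let T₁, T₂ : M → A be two Rota–Baxter operators on an anti-flexible algebra (A,·) with respect to a bimodule (M,l,r). (i) If T₁ and T₂ are compatible (i.e. T₁ + T₂ is also a Rota–Baxter operator) and T₂ is invertible, then N = T₁∘T₂⁻¹ : A → A is a Nijenhuis operator on (A,·). (ii) Conversely, if T₁ and T₂ are both invertible and N = T₁∘T₂⁻¹ is a Nijenhuis operator, then T₁ and T₂ are compatible. -/

import Mathlib

/-- The anti-flexible identity for a (bilinear) product. -/
def AntiFlexible {A : Type*} [AddCommGroup A] (mul : A → A → A) : Prop :=
  ∀ a b c : A, mul (mul a b) c - mul a (mul b c) = mul (mul c b) a - mul c (mul b a)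

/-- The bimodule equations for `(M, l, r)` over `(A, mul)`. -/
def IsBimodule {K A M : Type*} [Field K] [AddCommGroup A] [Module K A]
    [AddCommGroup M] [Module K M]
    (mul : A →ₗ[K] A →ₗ[K] A) (l r : A →ₗ[K] Module.End K M) : Prop :=
  (∀ a b : A, l (mul a b) - l a * l b = r a * r b - r (mul b a)) ∧
  (∀ a b : A, l a * r b - r b * l a = l b * r a - r a * l b)

/-- Rota–Baxter operator `T : M → A`. -/
def IsRotaBaxter {K A M : Type*} [Field K] [AddCommGroup A] [Module K A]
    [AddCommGroup M] [Module K M]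
    (mul : A →ₗ[K] A →ₗ[K] A) (l r : A →ₗ[K] Module.End K M) (T : M →ₗ[K] A) : Prop :=
  ∀ m n : M, mul (T m) (T n) = T (l (T m) n + r (T n) m)

/-- Nijenhuis operator on `(A, mul)`. -/
def IsNijenhuis {A : Type*} [AddCommGroup A] (mul : A → A → A) (N : A → A) : Prop :=
  ∀ a b : A, mul (N a) (N b) = N (mul (N a) b + mul a (N b) - N (mul a b))

/-- The sum of two Rota–Baxter operators is Rota–Baxter iff the mixed terms agree. -/
theorem IsRotaBaxter.add_iff {K A M : Type*} [Field K] [AddCommGroup A] [Module K A]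
    [AddCommGroup M] [Module K M] {mul : A →ₗ[K] A →ₗ[K] A} {l r : A →ₗ[K] Module.End K M}
    {T₁ T₂ : M →ₗ[K] A} (hT₁ : IsRotaBaxter mul l r T₁) (hT₂ : IsRotaBaxter mul l r T₂) :
    IsRotaBaxter mul l r (T₁ + T₂) ↔ ∀ m n : M,
      mul (T₁ m) (T₂ n) + mul (T₂ m) (T₁ n) =
        T₁ (l (T₂ m) n + r (T₂ n) m) + T₂ (l (T₁ m) n + r (T₁ n) m) := by
  refine forall₂_congr fun m n => ?_
  have h₁ := hT₁ m n
  have h₂ := hT₂ m n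
  simp only [LinearMap.add_apply, map_add] at h₁ h₂ ⊢
  rw [h₁, h₂]
  constructor <;> intro h <;> linear_combination (norm := abel) h

/-- (i) if `T₁, T₂` are compatible Rota–Baxter operators and `T₂` is
invertible (with inverse `T₂inv`), then `N = T₁ ∘ T₂⁻¹` is a Nijenhuis operator;
(ii) conversely, if `T₁` is also invertible and `N = T₁ ∘ T₂⁻¹` is a Nijenhuis
operator, then `T₁` and `T₂` are compatible. -/
theorem compatible_rotaBaxter_nijenhuis {K A M : Type*} [Field K]
    [AddCommGroup A] [Module K A] [AddCommGroup M] [Module K M]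
    (mul : A →ₗ[K] A →ₗ[K] A) (hA : AntiFlexible fun a b => mul a b)
    (l r : A →ₗ[K] Module.End K M) (hbim : IsBimodule mul l r)
    (T₁ T₂ : M →ₗ[K] A)
    (hT₁ : IsRotaBaxter mul l r T₁) (hT₂ : IsRotaBaxter mul l r T₂)
    (T₂inv : A →ₗ[K] M)
    (hinv₁ : T₂ ∘ₗ T₂inv = LinearMap.id) (hinv₂ : T₂inv ∘ₗ T₂ = LinearMap.id) :
    (IsRotaBaxter mul l r (T₁ + T₂) →
      IsNijenhuis (fun a b => mul a b) (T₁ ∘ₗ T₂inv)) ∧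
    (Function.Bijective T₁ →
      IsNijenhuis (fun a b => mul a b) (T₁ ∘ₗ T₂inv) →
      IsRotaBaxter mul l r (T₁ + T₂)) := by
  have hN (m : M) : T₁ (T₂inv (T₂ m)) = T₁ m :=
    congrArg T₁ (LinearMap.congr_fun hinv₂ m)
  have hsurj : Function.Surjective T₂ := fun a => ⟨T₂inv a, LinearMap.congr_fun hinv₁ a⟩
  rw [hT₁.add_iff hT₂]
  constructor
  · intro hcomp a b
    obtain ⟨m, rfl⟩ := hsurj a
    obtain ⟨n, rfl⟩ := hsurj b
    simp only [LinearMap.comp_apply, hN]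
    rw [hcomp m n, hT₂ m n, hN, add_sub_cancel_left, hN, hT₁ m n]
  · intro hbij hNij m n
    have h := hNij (T₂ m) (T₂ n)
    simp only [LinearMap.comp_apply, hN] at h
    rw [hT₁ m n, hT₂ m n, hN] at h
    have h' := congrArg T₂ (hbij.injective h)
    rw [← LinearMap.comp_apply T₂ T₂inv, hinv₁, LinearMap.id_apply] at h'
    rw [h', add_sub_cancel]
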